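/- arXiv:1102.4065 — 2 statements merged into one kernel-verified Lean document; each statement's English description precedes it below -/
import Mathlib

section
/- Restricted to weight-δ symbols homogeneous of degree k in p lying in ker T (traceless symbols), the commutator of D_0^d (the d-th power of the divergence restricted and corestricted to ker T) with the conformal action of the inversion X_i satisfies [D_0^d, L^δ_{X_i}] = 2d(2k - d - 1 + n(1-δ))·∂_{p^i}D_0^{d-1}. -/
open MvPolynomial

noncomputable section

/-- Polynomial symbols: polynomial functions on `T*ℝⁿ`; `Sum.inl` are the `x` variables,
`Sum.inr` the fiber variables `p`. -/
abbrev PolySym (n : ℕ) := MvPolynomial (Fin n ⊕ Fin n) ℝ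

/-- Polynomial functions on `ℝⁿ` (densities are identified with these). -/
abbrev PolyDen (n : ℕ) := MvPolynomial (Fin n) ℝ

/-- Polynomial vector fields on `ℝⁿ`, given by their components. -/
abbrev PolyVF (n : ℕ) := Fin n → PolyDen n

/-- `∂/∂x^i` on symbols. -/
def dxOp (n : ℕ) (i : Fin n) : Module.End ℝ (PolySym n) := (pderiv (Sum.inl i)).toLinearMap

/-- `∂/∂p_i` on symbols. -/
def dpOp (n : ℕ) (i : Fin n) : Module.End ℝ (PolySym n) := (pderiv (Sum.inr i)).toLinearMap

/-- Multiplication by a symbol. -/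
def mulOp (n : ℕ) (q : PolySym n) : Module.End ℝ (PolySym n) := LinearMap.mulLeft ℝ q

/-- The symbol `x^i`. -/
def xVar (n : ℕ) (i : Fin n) : PolySym n := X (Sum.inl i)

/-- The symbol `p_i`. -/
def pVar (n : ℕ) (i : Fin n) : PolySym n := X (Sum.inr i)

/-- A polynomial in `x` viewed as a symbol. -/
def liftX (n : ℕ) (f : PolyDen n) : PolySym n := rename Sum.inl f

/-- Divergence of a vector field. -/
def divVF (n : ℕ) (Xf : PolyVF n) : PolyDen n := ∑ i, pderiv i (Xf i)

/-- Weight function computing the degree in the `p` variables. -/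
def pwt (n : ℕ) : Fin n ⊕ Fin n → ℕ := Sum.elim (fun _ => 0) (fun _ => 1)

/-- Homogeneity of degree `k` in the fiber variables `p`. -/
def IsPHomog (n : ℕ) (P : PolySym n) (k : ℕ) : Prop := IsWeightedHomogeneous (pwt n) P k

/-- The weight-`δ` action `L^δ_X = X^i ∂_{x^i} - p_j (∂_{x^i} X^j) ∂_{p_i} + δ Div(X)` of a
vector field on symbols. -/
def Lop (n : ℕ) (δ : ℝ) (Xf : PolyVF n) : Module.End ℝ (PolySym n) :=
  (∑ i, mulOp n (liftX n (Xf i)) ∘ₗ dxOp n i)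
    - (∑ i, ∑ j, mulOp n (pVar n j * liftX n (pderiv i (Xf j))) ∘ₗ dpOp n i)
    + δ • mulOp n (liftX n (divVF n Xf))

/-- The action `ℓ^λ_X = X + λ Div(X)` of a vector field on `λ`-densities. -/
def ellOp (n : ℕ) (lam : ℝ) (Xf : PolyVF n) : Module.End ℝ (PolyDen n) :=
  (∑ i, LinearMap.mulLeft ℝ (Xf i) ∘ₗ (pderiv i).toLinearMap)
    + lam • LinearMap.mulLeft ℝ (divVF n Xf)

/-- Lie bracket of polynomial vector fields. -/
def bracketVF (n : ℕ) (Xf Yf : PolyVF n) : PolyVF n :=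
  fun i => ∑ j, (Xf j * pderiv j (Yf i) - Yf j * pderiv j (Xf i))
/-- The trace operator `T = η_{ij} ∂_{p_i} ∂_{p_j}` for the diagonal metric with entries `ε`. -/
def traceOp (n : ℕ) (ε : Fin n → ℝ) : Module.End ℝ (PolySym n) :=
  ∑ i, ε i • (dpOp n i ∘ₗ dpOp n i)

/-- The Euler operator `E = p_i ∂_{p_i}`. -/
def eulerOp (n : ℕ) : Module.End ℝ (PolySym n) := ∑ i, mulOp n (pVar n i) ∘ₗ dpOp n i

/-- The quadratic symbol `R = η^{ij} p_i p_j` (the metric). -/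
def rQuad (n : ℕ) (ε : Fin n → ℝ) : PolySym n := ∑ i, ε i • (pVar n i * pVar n i)

/-- Multiplication by the metric symbol `R`. -/
def rOp (n : ℕ) (ε : Fin n → ℝ) : Module.End ℝ (PolySym n) := mulOp n (rQuad n ε)

/-- The divergence operator `D = ∂_{x^i} ∂_{p_i}` on symbols. -/
def divOp (n : ℕ) : Module.End ℝ (PolySym n) := ∑ i, dxOp n i ∘ₗ dpOp n i

/-- The gradient operator `G = η^{ij} p_i ∂_{x^j}`. -/
def gradOp (n : ℕ) (ε : Fin n → ℝ) : Module.End ℝ (PolySym n) :=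
  ∑ i, ε i • (mulOp n (pVar n i) ∘ₗ dxOp n i)

/-- The translation vector field `∂_i`. -/
def transVF (n : ℕ) (i : Fin n) : PolyVF n := fun j => if j = i then 1 else 0

/-- The dilation vector field `x^i ∂_i`. -/
def dilVF (n : ℕ) : PolyVF n := fun j => X j

/-- The rotation vector field `x_j ∂_i - x_i ∂_j` for the diagonal metric `ε`. -/
def rotVF (n : ℕ) (ε : Fin n → ℝ) (i j : Fin n) : PolyVF n :=
  fun m => (if m = i then ε j • X j else 0) - (if m = j then ε i • X i else 0)

/-- The conformal inversion `X_i = x_j x^j ∂_i - 2 x_i x^j ∂_j`. -/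
def invVF (n : ℕ) (ε : Fin n → ℝ) (i : Fin n) : PolyVF n :=
  fun j => (if j = i then ∑ m, ε m • (X m * X m) else 0) - (2 * ε i) • (X i * X j)

/-- Generators of the conformal Lie algebra: translations, rotations, the dilation and the
conformal inversions. -/
def confGenSet (n : ℕ) (ε : Fin n → ℝ) : Set (PolyVF n) :=
  Set.range (transVF n) ∪ {Xf | ∃ i j, Xf = rotVF n ε i j} ∪ {dilVF n} ∪
    Set.range (invVF n ε)

lemma pd_comm {n : ℕ} (a b : Fin n ⊕ Fin n) (Q : PolySym n) :
    pderiv a (pderiv b Q) = pderiv b (pderiv a Q) := by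
  have h : ⁅(pderiv a : Derivation ℝ (PolySym n) (PolySym n)),
      (pderiv b : Derivation ℝ (PolySym n) (PolySym n))⁆ = 0 := by
    apply MvPolynomial.derivation_ext
    intro i
    simp only [Derivation.commutator_apply, pderiv_X, Pi.single_apply, Derivation.zero_apply]
    split_ifs <;> simp
  have := congrArg (fun D => D Q) h
  simpa [Derivation.commutator_apply, sub_eq_zero] using this

lemma dx_lift {n : ℕ} (l : Fin n) (f : PolyDen n) :
    pderiv (Sum.inl l) (liftX n f) = liftX n (pderiv l f) :=
  pderiv_rename Sum.inl_injective l f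

lemma dp_lift {n : ℕ} (l : Fin n) (f : PolyDen n) :
    pderiv (Sum.inr l) (liftX n f) = 0 := by
  unfold liftX
  induction f using MvPolynomial.induction_on with
  | C a => simp
  | add p q hp hq => simp [hp, hq]
  | mul_X p i hp => simp [hp, pderiv_X]

lemma divOp_apply {n : ℕ} (Q : PolySym n) :
    divOp n Q = ∑ l, pderiv (Sum.inl l) (pderiv (Sum.inr l) Q) := by
  simp [divOp, dxOp, dpOp]

lemma div_pd {n : ℕ} (a : Fin n ⊕ Fin n) (Q : PolySym n) :
    divOp n (pderiv a Q) = pderiv a (divOp n Q) := by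
  simp only [divOp_apply, map_sum]
  refine Finset.sum_congr rfl fun l _ => ?_
  rw [pd_comm _ a, pd_comm _ a]

lemma div_pow_pd {n : ℕ} (d : ℕ) (a : Fin n ⊕ Fin n) (Q : PolySym n) :
    (divOp n ^ d) (pderiv a Q) = pderiv a ((divOp n ^ d) Q) := by
  induction d generalizing Q with
  | zero => simp
  | succ d ih => rw [pow_succ, Module.End.mul_apply, Module.End.mul_apply, div_pd, ih]

lemma div_lift_mul {n : ℕ} (f : PolyDen n) (Q : PolySym n) :
    divOp n (liftX n f * Q)
      = liftX n f * divOp n Q + ∑ l, liftX n (pderiv l f) * pderiv (Sum.inr l) Q := by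
  simp only [divOp_apply, Finset.mul_sum, ← Finset.sum_add_distrib]
  refine Finset.sum_congr rfl fun l _ => ?_
  simp only [pderiv_mul, dp_lift, dx_lift, zero_mul, zero_add]
  ring

lemma div_p_mul {n : ℕ} (m : Fin n) (Q : PolySym n) :
    divOp n (pVar n m * Q) = pVar n m * divOp n Q + pderiv (Sum.inl m) Q := by
  have : ∀ l : Fin n, pderiv (Sum.inl l) (pderiv (Sum.inr l) (pVar n m * Q))
      = pVar n m * pderiv (Sum.inl l) (pderiv (Sum.inr l) Q)
        + if l = m then pderiv (Sum.inl l) Q else 0 := by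
    intro l
    by_cases h : l = m
    · subst h; simp [pVar, pderiv_mul, pderiv_X]
    · simp [pVar, pderiv_mul, pderiv_X, h, Ne.symm h, Pi.single_apply]
  simp only [divOp_apply, this, Finset.sum_add_distrib, Finset.mul_sum]
  simp

lemma Lop_apply {n : ℕ} (δ : ℝ) (Xf : PolyVF n) (Q : PolySym n) :
    Lop n δ Xf Q = (∑ j, liftX n (Xf j) * pderiv (Sum.inl j) Q)
      - (∑ j, ∑ m, pVar n m * (liftX n (pderiv j (Xf m)) * pderiv (Sum.inr j) Q))
      + δ • (liftX n (divVF n Xf) * Q) := by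
  simp [Lop, mulOp, dxOp, dpOp, mul_assoc]

lemma div_Lop {n : ℕ} (δ : ℝ) (Xf : PolyVF n) (Q : PolySym n) :
    divOp n (Lop n δ Xf Q) - Lop n δ Xf (divOp n Q)
      = - (∑ j, ∑ m, pVar n m * ∑ l, liftX n (pderiv l (pderiv j (Xf m))) *
            pderiv (Sum.inr l) (pderiv (Sum.inr j) Q))
        - (1 - δ) • ∑ j, liftX n (pderiv j (divVF n Xf)) * pderiv (Sum.inr j) Q := by
  have e1 : ∑ j, ∑ l, liftX n (pderiv l (Xf j)) * pderiv (Sum.inr l) (pderiv (Sum.inl j) Q)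
      = ∑ j, ∑ m, liftX n (pderiv j (Xf m)) * pderiv (Sum.inl m) (pderiv (Sum.inr j) Q) := by
    rw [Finset.sum_comm]
    simp only [pd_comm (Sum.inl _) (Sum.inr _)]
  have e2 : ∑ j, liftX n (pderiv j (divVF n Xf)) * pderiv (Sum.inr j) Q
      = ∑ j, ∑ m, liftX n (pderiv m (pderiv j (Xf m))) * pderiv (Sum.inr j) Q := by
    refine Finset.sum_congr rfl fun j _ => ?_
    rw [← Finset.sum_mul]
    congr 1
    simp only [divVF, liftX, map_sum]
    refine Finset.sum_congr rfl fun m _ => ?_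
    have h := pd_comm (n := n) (Sum.inl j) (Sum.inl m) (liftX n (Xf m))
    simp only [dx_lift] at h
    exact h
  simp only [Lop_apply, map_add, map_sub, map_sum, map_smul, div_lift_mul, div_p_mul, div_pd,
    pderiv_mul, dx_lift, mul_add, Finset.sum_add_distrib, smul_add]
  rw [e1, sub_smul, one_smul, e2]
  abel

lemma inv_d1 {n : ℕ} (ε : Fin n → ℝ) (i j m : Fin n) :
    pderiv j (invVF n ε i m) = (if m = i then (2 * ε j) • X j else 0)
      - (2 * ε i) • ((if i = j then X m else 0) + (if m = j then X i else 0)) := by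
  have h : pderiv j (∑ m : Fin n, ε m • (X m * X m) : PolyDen n) = (2 * ε j) • X j := by
    simp only [map_sum, Derivation.map_smul, pderiv_mul, pderiv_X, Pi.single_apply]
    rw [Finset.sum_eq_single j]
    · simp only [if_true, mul_one, one_mul]; module
    · intro b _ hb; simp [Ne.symm hb, hb]
    · simp
  unfold invVF
  rw [map_sub, apply_ite (pderiv j), h, map_zero]
  simp only [Derivation.map_smul, pderiv_mul, pderiv_X, Pi.single_apply]
  congr 2
  split_ifs <;> simp_all

lemma inv_d2 {n : ℕ} (ε : Fin n → ℝ) (i j m l : Fin n) :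
    pderiv l (pderiv j (invVF n ε i m)) = C ((if m = i then if j = l then 2 * ε j else 0 else 0)
      - (2 * ε i) * ((if i = j then if m = l then 1 else 0 else 0)
        + (if m = j then if i = l then 1 else 0 else 0))) := by
  rw [inv_d1]
  simp only [map_sub, Derivation.map_smul, map_add, apply_ite (pderiv l), map_zero, pderiv_X,
    Pi.single_apply, smul_eq_C_mul, C_mul, apply_ite C, C_1]
  split_ifs <;> simp_all

lemma invVF_div {n : ℕ} (ε : Fin n → ℝ) (i : Fin n) :
    divVF n (invVF n ε i) = (-(2 * n * ε i) : ℝ) • X i := by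
  simp only [divVF, inv_d1, Finset.sum_sub_distrib, ← Finset.smul_sum, Finset.sum_add_distrib]
  simp
  rw [← nsmul_eq_mul, ← Nat.cast_smul_eq_nsmul ℝ]
  module

lemma inv_comm {n : ℕ} (δ : ℝ) (ε : Fin n → ℝ) (i : Fin n) (Q : PolySym n) :
    divOp n (Lop n δ (invVF n ε i) Q) - Lop n δ (invVF n ε i) (divOp n Q)
      = - ((2:ℝ) • (pVar n i * traceOp n ε Q))
        + (4 * ε i) • eulerOp n (pderiv (Sum.inr i) Q)
        + (2 * n * ε i * (1 - δ)) • pderiv (Sum.inr i) Q := by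
  have hl : ∀ (c : ℝ) (R : PolySym n), liftX n (C c) * R = c • R := by
    intro c R; simp [liftX, smul_eq_C_mul]
  have e2 : ∑ j, liftX n (pderiv j (divVF n (invVF n ε i))) * pderiv (Sum.inr j) Q
      = (-(2 * n * ε i) : ℝ) • pderiv (Sum.inr i) Q := by
    have : ∀ j, pderiv j (divVF n (invVF n ε i)) = C (if i = j then -(2 * n * ε i) else 0) := by
      intro j
      rw [invVF_div, Derivation.map_smul, pderiv_X, Pi.single_apply, smul_eq_C_mul]
      split_ifs <;> simp_all
    simp only [this, hl, ite_smul, zero_smul, Finset.sum_ite_eq, Finset.mem_univ, if_true]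
  have e1 : ∑ j, ∑ m, pVar n m * ∑ l, liftX n (pderiv l (pderiv j (invVF n ε i m))) *
            pderiv (Sum.inr l) (pderiv (Sum.inr j) Q)
      = (2:ℝ) • (pVar n i * traceOp n ε Q) - (4 * ε i) • eulerOp n (pderiv (Sum.inr i) Q) := by
    simp only [inv_d2, hl, sub_smul, Finset.sum_sub_distrib, mul_smul, add_smul, mul_sub, ite_smul,
      zero_smul, ← Finset.smul_sum, Finset.sum_add_distrib, mul_add, mul_smul_comm, one_smul]
    simp only [Finset.sum_ite_irrel, Finset.sum_const_zero, Finset.sum_ite_eq, Finset.sum_ite_eq',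
      Finset.mem_univ, if_true, mul_ite, mul_zero]
    simp only [traceOp, eulerOp, mulOp, dpOp, LinearMap.sum_apply, LinearMap.smul_apply,
      LinearMap.comp_apply, Finset.mul_sum, Finset.smul_sum, LinearMap.mulLeft_apply,
      Derivation.coeFn_coe, mul_smul_comm]
    congr 1
    rw [← Finset.sum_add_distrib]
    refine Finset.sum_congr rfl fun x _ => ?_
    rw [pd_comm (Sum.inr i) (Sum.inr x)]
    module
  rw [div_Lop, e1, e2]
  module

lemma euler_apply {n : ℕ} (Q : PolySym n) :
    eulerOp n Q = ∑ l, pVar n l * pderiv (Sum.inr l) Q := by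
  simp [eulerOp, mulOp, dpOp]

lemma euler_dp {n : ℕ} (a : Fin n) (Q : PolySym n) :
    eulerOp n (pderiv (Sum.inr a) Q)
      = pderiv (Sum.inr a) (eulerOp n Q) - pderiv (Sum.inr a) Q := by
  have : ∀ l : Fin n, pderiv (Sum.inr a) (pVar n l * pderiv (Sum.inr l) Q)
      = pVar n l * pderiv (Sum.inr l) (pderiv (Sum.inr a) Q)
        + if l = a then pderiv (Sum.inr a) Q else 0 := by
    intro l
    rw [pderiv_mul, pd_comm (Sum.inr a) (Sum.inr l)]
    by_cases h : l = a
    · subst h; simp [pVar]; ring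
    · simp [pVar, pderiv_X, h, Pi.single_apply]
  simp only [euler_apply, map_sum, this, Finset.sum_add_distrib]
  simp

lemma euler_dx {n : ℕ} (a : Fin n) (Q : PolySym n) :
    eulerOp n (pderiv (Sum.inl a) Q) = pderiv (Sum.inl a) (eulerOp n Q) := by
  simp only [euler_apply, map_sum]
  refine Finset.sum_congr rfl fun l _ => ?_
  rw [pderiv_mul, pd_comm (Sum.inl a) (Sum.inr l)]
  simp [pVar, pderiv_X]

lemma euler_div {n : ℕ} (Q : PolySym n) :
    eulerOp n (divOp n Q) = divOp n (eulerOp n Q) - divOp n Q := by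
  simp only [divOp_apply, map_sum, euler_dx, euler_dp, map_sub, Finset.sum_sub_distrib]

lemma trace_div {n : ℕ} (ε : Fin n → ℝ) (Q : PolySym n) :
    traceOp n ε (divOp n Q) = divOp n (traceOp n ε Q) := by
  simp [traceOp, dpOp, div_pd]

lemma main_aux {n : ℕ} (δ : ℝ) (ε : Fin n → ℝ) (i : Fin n) (d : ℕ) (κ : ℝ) (P : PolySym n)
    (hP : eulerOp n P = κ • P) (hT : traceOp n ε P = 0) :
    (divOp n ^ (d + 1)) (Lop n δ (invVF n ε i) P)
        - Lop n δ (invVF n ε i) ((divOp n ^ (d + 1)) P)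
      = (2 * ((d : ℝ) + 1) * (2 * κ - ((d : ℝ) + 1) - 1 + (n : ℝ) * (1 - δ))) •
          (ε i • pderiv (Sum.inr i) ((divOp n ^ d) P)) := by
  have h1 : divOp n (Lop n δ (invVF n ε i) P) = Lop n δ (invVF n ε i) (divOp n P)
      + (2 * (2 * κ - 2 + (n : ℝ) * (1 - δ))) • (ε i • pderiv (Sum.inr i) P) := by
    rw [← sub_eq_iff_eq_add', inv_comm, hT, euler_dp, hP, Derivation.map_smul, mul_zero]
    module
  induction d generalizing κ P with
  | zero =>
    simp only [zero_add, pow_one, pow_zero, Module.End.one_apply, h1, Nat.cast_zero]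
    module
  | succ d ih =>
    have hE : eulerOp n (divOp n P) = (κ - 1) • divOp n P := by
      rw [euler_div, hP, map_smul]; module
    have hT' : traceOp n ε (divOp n P) = 0 := by rw [trace_div, hT, map_zero]
    have h2 : divOp n (Lop n δ (invVF n ε i) (divOp n P))
        = Lop n δ (invVF n ε i) (divOp n (divOp n P))
      + (2 * (2 * (κ - 1) - 2 + (n : ℝ) * (1 - δ))) • (ε i • pderiv (Sum.inr i) (divOp n P)) := by
      rw [← sub_eq_iff_eq_add', inv_comm, hT', euler_dp, hE, Derivation.map_smul, mul_zero]
      module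
    have key := ih (κ - 1) (divOp n P) hE hT' h2
    have e : ∀ (m : ℕ) (R : PolySym n), (divOp n ^ (m + 1)) R = (divOp n ^ m) (divOp n R) := by
      intro m R; rw [pow_succ, Module.End.mul_apply]
    rw [sub_eq_iff_eq_add] at key
    rw [e (d + 1), h1, map_add, key, e (d + 1) P, map_smul, map_smul, div_pow_pd, e d P]
    push_cast
    module

lemma euler_homog {n k : ℕ} {P : PolySym n} (hP : IsPHomog n P k) :
    eulerOp n P = (k : ℝ) • P := by
  have h := IsWeightedHomogeneous.sum_weight_X_mul_pderiv hP
  rw [Fintype.sum_sum_type] at h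
  simp [pwt] at h
  rw [euler_apply, Nat.cast_smul_eq_nsmul]
  simpa [pVar] using h

/-- On weight-`δ` symbols homogeneous of degree `k` in `p` and lying in
`ker T` (traceless symbols), the commutator of `D_0^d` with the conformal action of the
inversion `X_i` satisfies `[D_0^d, L^δ_{X_i}] = 2d(2k - d - 1 + n(1-δ)) ∂_{p^i} D_0^{d-1}`. -/
theorem divOp_pow_commutator_conformal_traceless (n k d : ℕ) (hd : 1 ≤ d) (δ : ℝ)
    (ε : Fin n → ℝ) (hε : ∀ i, ε i = 1 ∨ ε i = -1) (i : Fin n)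
    (P : PolySym n) (hP : IsPHomog n P k) (hT : traceOp n ε P = 0) :
    (divOp n ^ d) (Lop n δ (invVF n ε i) P) - Lop n δ (invVF n ε i) ((divOp n ^ d) P)
      = (2 * (d : ℝ) * (2 * (k : ℝ) - (d : ℝ) - 1 + (n : ℝ) * (1 - δ))) •
          (ε i • dpOp n i ((divOp n ^ (d - 1)) P)) := by
  obtain ⟨d, rfl⟩ : ∃ e, d = e + 1 := ⟨d - 1, by omega⟩
  have h := main_aux δ ε i d (k : ℝ) P (euler_homog hP) hT
  simp only [Nat.add_sub_cancel, dpOp, Nat.cast_add, Nat.cast_one]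
  exact h
end
end

section
/- The operator G_0^g : S^δ_{k,0} → S^{δ+2g/n}_{k+g,0} (g-th power of the traceless gradient, the g-generalized conformal Killing operator) is conformally invariant (commutes with the actions of the full conformal algebra o(p+1,q+1)) if and only if δ = (1-g)/n. -/
open MvPolynomial

noncomputable section

/-! ### Fischer inner product -/

/-- The factorial weight of an exponent. -/
def fisW {σ : Type*} [Fintype σ] (m : σ →₀ ℕ) : ℝ := ∏ i, ((m i).factorial : ℝ)

/-- The Fischer pairing. -/
def fisB (σ : Type*) [Fintype σ] :
    MvPolynomial σ ℝ →ₗ[ℝ] MvPolynomial σ ℝ →ₗ[ℝ] ℝ :=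
  (basisMonomials σ ℝ).constr ℝ (fun m => fisW m • lcoeff ℝ m)

lemma fisB_monomial {σ : Type*} [Fintype σ] (m : σ →₀ ℕ) (a : ℝ) (Q : MvPolynomial σ ℝ) :
    fisB σ (monomial m a) Q = a * (fisW m * coeff m Q) := by
  have h : fisB σ (monomial m 1) = fisW m • lcoeff ℝ m := by
    have := (basisMonomials σ ℝ).constr_basis ℝ (fun m => fisW m • lcoeff ℝ m) m
    simpa [fisB] using this
  have h2 : (monomial m a : MvPolynomial σ ℝ) = a • monomial m 1 := by simp [smul_monomial]
  rw [h2, map_smul, h]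
  simp

lemma fisW_succ {σ : Type*} [Fintype σ] (m : σ →₀ ℕ) (i : σ) :
    fisW (m + Finsupp.single i 1) = ((m i : ℝ) + 1) * fisW m := by
  classical
  unfold fisW
  rw [← Finset.mul_prod_erase _ _ (Finset.mem_univ i),
    ← Finset.mul_prod_erase (f := fun j => ((m j).factorial : ℝ)) _ (Finset.mem_univ i), ← mul_assoc]
  congr 1
  · simp [Nat.factorial_succ]
  · apply Finset.prod_congr rfl
    intro j hj
    have : i ≠ j := fun h => (Finset.mem_erase.1 hj).1 h.symm
    simp [Finsupp.single_eq_of_ne' this]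

lemma fisB_X_mul {σ : Type*} [Fintype σ] (i : σ) (P Q : MvPolynomial σ ℝ) :
    fisB σ (X i * P) Q = fisB σ P (pderiv i Q) := by
  induction P using MvPolynomial.induction_on' with
  | monomial m a =>
    have : (X i * monomial m a : MvPolynomial σ ℝ) = monomial (m + Finsupp.single i 1) a := by
      rw [X, monomial_mul, add_comm, one_mul]
    rw [this, fisB_monomial, fisB_monomial, coeff_pderiv, fisW_succ]
    ring
  | add p q hp hq => simp [mul_add, hp, hq]

lemma fisB_self_eq_zero {σ : Type*} [Fintype σ] (P : MvPolynomial σ ℝ) (h : fisB σ P P = 0) :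
    P = 0 := by
  have h1 : fisB σ P P = ∑ m ∈ P.support, coeff m P * (fisW m * coeff m P) := by
    conv_lhs => rw [LinearMap.congr_arg (f := fisB σ) P.as_sum]
    rw [map_sum, LinearMap.sum_apply]
    exact Finset.sum_congr rfl fun m _ => fisB_monomial m _ _
  have hw : ∀ m : σ →₀ ℕ, 0 < fisW m := fun m =>
    Finset.prod_pos fun i _ => by exact_mod_cast Nat.factorial_pos _
  rw [h1, Finset.sum_eq_zero_iff_of_nonneg] at h
  · ext m
    by_cases hm : m ∈ P.support
    · have := h m hm
      have hw := (hw m).ne'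
      simp_all
    · simpa using hm
  · intro m _
    have := hw m
    have : coeff m P * (fisW m * coeff m P) = fisW m * (coeff m P)^2 := by ring
    rw [this]; positivity

lemma rQuad_mul_eq_zero_of_traceless {n : ℕ} {ε : Fin n → ℝ} (Q : PolySym n)
    (h : traceOp n ε (rQuad n ε * Q) = 0) : rQuad n ε * Q = 0 := by
  apply fisB_self_eq_zero
  have key : ∀ S : PolySym n, fisB _ (rQuad n ε * Q) S = fisB _ Q (traceOp n ε S) := by
    intro S
    simp only [rQuad, traceOp, Finset.sum_mul, map_sum, LinearMap.sum_apply, smul_mul_assoc,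
      map_smul, LinearMap.smul_apply, pVar, mul_assoc, fisB_X_mul, dpOp, LinearMap.comp_apply]
    rfl
  rw [key, h, map_zero]

lemma eq_of_traceless {n : ℕ} {ε : Fin n → ℝ} {A B : PolySym n}
    (hA : traceOp n ε A = 0) (hB : traceOp n ε B = 0) (h : rQuad n ε ∣ A - B) : A = B := by
  obtain ⟨Q, hQ⟩ := h
  have : traceOp n ε (rQuad n ε * Q) = 0 := by rw [← hQ, map_sub, hA, hB, sub_zero]
  rw [rQuad_mul_eq_zero_of_traceless Q this] at hQ
  exact sub_eq_zero.1 hQ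

/-! ### The vector field action and the gradient as derivations -/

lemma der_sum_apply {ι : Type*} {σ : Type*} (s : Finset ι)
    (D : ι → Derivation ℝ (MvPolynomial σ ℝ) (MvPolynomial σ ℝ)) (P : MvPolynomial σ ℝ) :
    (∑ i ∈ s, D i) P = ∑ i ∈ s, D i P := by
  classical
  induction s using Finset.induction_on with
  | empty => simp
  | insert a s ha ih => rw [Finset.sum_insert ha, Finset.sum_insert ha, Derivation.add_apply, ih]

lemma two_cancel {σ : Type*} {a b : MvPolynomial σ ℝ} (h : 2 * a = 2 * b) : a = b :=
  mul_left_cancel₀ (two_ne_zero) h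

lemma der_C_mul {σ : Type*} (D : Derivation ℝ (MvPolynomial σ ℝ) (MvPolynomial σ ℝ)) (a : ℝ)
    (P : MvPolynomial σ ℝ) : D (C a * P) = C a * D P := by
  rw [Derivation.leibniz, derivation_C, smul_zero, add_zero, smul_eq_mul]

/-- The gradient as a derivation. -/
def gradD (n : ℕ) (ε : Fin n → ℝ) : Derivation ℝ (PolySym n) (PolySym n) :=
  ∑ i, (C (ε i) * pVar n i) • pderiv (Sum.inl i)

/-- The hamiltonian lift of a vector field as a derivation. -/
def liftD (n : ℕ) (Xf : PolyVF n) : Derivation ℝ (PolySym n) (PolySym n) :=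
  (∑ i, liftX n (Xf i) • pderiv (Sum.inl i))
    - ∑ i, ∑ j, (pVar n j * liftX n (pderiv i (Xf j))) • pderiv (Sum.inr i)

lemma gradD_apply (n : ℕ) (ε : Fin n → ℝ) (P : PolySym n) :
    gradD n ε P = ∑ i, C (ε i) * pVar n i * pderiv (Sum.inl i) P := by
  simp [gradD, der_sum_apply]

lemma liftD_apply (n : ℕ) (Xf : PolyVF n) (P : PolySym n) :
    liftD n Xf P = (∑ i, liftX n (Xf i) * pderiv (Sum.inl i) P)
    - ∑ i, ∑ j, (pVar n j * liftX n (pderiv i (Xf j))) * pderiv (Sum.inr i) P := by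
  simp [liftD, der_sum_apply]

lemma gradOp_eq (n : ℕ) (ε : Fin n → ℝ) (P : PolySym n) : gradOp n ε P = gradD n ε P := by
  simp [gradD_apply, gradOp, mulOp, dxOp, MvPolynomial.smul_eq_C_mul, mul_assoc]

lemma Lop_eq (n : ℕ) (δ : ℝ) (Xf : PolyVF n) (P : PolySym n) :
    Lop n δ Xf P = liftD n Xf P + C δ * liftX n (divVF n Xf) * P := by
  simp [liftD_apply, Lop, mulOp, dxOp, dpOp, MvPolynomial.smul_eq_C_mul, mul_assoc]

lemma traceOp_apply (n : ℕ) (ε : Fin n → ℝ) (P : PolySym n) :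
    traceOp n ε P = ∑ i, C (ε i) * pderiv (Sum.inr i) (pderiv (Sum.inr i) P) := by
  simp [traceOp, dpOp, MvPolynomial.smul_eq_C_mul]

lemma rQuad_eq (n : ℕ) (ε : Fin n → ℝ) :
    rQuad n ε = ∑ i, C (ε i) * (pVar n i * pVar n i) := by
  simp [rQuad, MvPolynomial.smul_eq_C_mul]

lemma dx_liftX {n : ℕ} (i : Fin n) (f : PolyDen n) :
    pderiv (Sum.inl i) (liftX n f) = liftX n (pderiv i f) := 
  pderiv_rename Sum.inl_injective i f

lemma dp_liftX {n : ℕ} (i : Fin n) (f : PolyDen n) :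
    pderiv (Sum.inr i) (liftX n f) = 0 := by
  classical
  apply pderiv_eq_zero_of_notMem_vars
  intro h
  have := vars_rename (Sum.inl : Fin n → Fin n ⊕ Fin n) f h
  simp at this

lemma dx_pVar {n : ℕ} (i j : Fin n) : pderiv (Sum.inl i) (pVar n j) = 0 :=
  pderiv_X_of_ne (by simp)

lemma dp_pVar {n : ℕ} (i j : Fin n) : pderiv (Sum.inr i) (pVar n j) = if j = i then 1 else 0 := by
  classical
  rw [pVar, pderiv_X]
  by_cases h : j = i <;> simp [Pi.single_apply, h]

lemma pderiv_comm' {σ : Type*} (i j : σ) (P : MvPolynomial σ ℝ) :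
    pderiv i (pderiv j P) = pderiv j (pderiv i P) := by
  classical
  have : ⁅pderiv (R := ℝ) i, pderiv (R := ℝ) j⁆ = 0 := by
    apply derivation_ext
    intro k
    rw [Derivation.commutator_apply]
    simp [pderiv_X, Pi.single_apply, apply_ite]
  have h := DFunLike.congr_fun this P
  rw [Derivation.commutator_apply] at h
  exact sub_eq_zero.1 h

lemma gradD_liftX {n : ℕ} (ε : Fin n → ℝ) (f : PolyDen n) :
    gradD n ε (liftX n f) = ∑ i, C (ε i) * pVar n i * liftX n (pderiv i f) := by
  simp [gradD_apply, dx_liftX]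

lemma gradD_pVar {n : ℕ} (ε : Fin n → ℝ) (j : Fin n) : gradD n ε (pVar n j) = 0 := by
  simp [gradD_apply, dx_pVar]

lemma gradD_C {n : ℕ} (ε : Fin n → ℝ) (a : ℝ) : gradD n ε (C a) = 0 := derivation_C _ _

lemma gradD_rQuad {n : ℕ} (ε : Fin n → ℝ) : gradD n ε (rQuad n ε) = 0 := by
  simp [rQuad_eq, gradD_pVar, der_C_mul, Derivation.leibniz]

lemma liftD_pVar {n : ℕ} (Xf : PolyVF n) (k : Fin n) :
    liftD n Xf (pVar n k) = - ∑ j, pVar n j * liftX n (pderiv k (Xf j)) := by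
  simp [liftD_apply, dx_pVar, dp_pVar, Finset.sum_ite_eq]

lemma liftD_X {n : ℕ} (Xf : PolyVF n) (k : Fin n) :
    liftD n Xf (X (Sum.inl k)) = liftX n (Xf k) := by
  classical
  have h : ∀ i : Fin n, pderiv (Sum.inr i) (X (Sum.inl k) : PolySym n) = 0 :=
    fun i => pderiv_X_of_ne (by simp)
  simp [liftD_apply, h, pderiv_X, Pi.single_apply]

/-- The conformal Killing equation. -/
def IsConf (n : ℕ) (ε : Fin n → ℝ) (Xf : PolyVF n) (f : PolyDen n) : Prop :=
  ∀ i j, C (ε i) * pderiv i (Xf j) + C (ε j) * pderiv j (Xf i) =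
    if i = j then 2 * C (ε i) * f else 0

lemma IsConf.div {n : ℕ} {ε : Fin n → ℝ} (hε : ∀ i, ε i = 1 ∨ ε i = -1) {Xf : PolyVF n}
    {f : PolyDen n} (h : IsConf n ε Xf f) : divVF n Xf = C (n : ℝ) * f := by
  have : ∀ i, pderiv i (Xf i) = f := by
    intro i
    have := h i i
    rw [if_pos rfl] at this
    apply two_cancel
    rcases hε i with h | h <;> rw [h] at this <;> simp only [C_neg, C_1] at this
    · linear_combination this
    · linear_combination -this
  simp [divVF, this]

lemma liftX_C {n : ℕ} (a : ℝ) : liftX n (C a) = C a := by simp [liftX]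
lemma liftX_add {n : ℕ} (a b : PolyDen n) : liftX n (a + b) = liftX n a + liftX n b := by
  simp [liftX]
lemma liftX_mul {n : ℕ} (a b : PolyDen n) : liftX n (a * b) = liftX n a * liftX n b := by
  simp [liftX]

lemma liftX_two {n : ℕ} : liftX n 2 = 2 := map_ofNat _ 2

lemma IsConf.lift {n : ℕ} {ε : Fin n → ℝ} {Xf : PolyVF n}
    {f : PolyDen n} (h : IsConf n ε Xf f) (i j : Fin n) :
    C (ε i) * liftX n (pderiv i (Xf j)) + C (ε j) * liftX n (pderiv j (Xf i)) =
    if i = j then 2 * C (ε i) * liftX n f else 0 := by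
  have := congrArg (liftX n) (h i j)
  simp only [liftX_add, liftX_mul, liftX_C] at this
  rw [this]
  split_ifs
  · rw [liftX_mul, liftX_mul, liftX_two, liftX_C]
  · simp [liftX]

lemma IsConf.lift2 {n : ℕ} {ε : Fin n → ℝ} {Xf : PolyVF n}
    {f : PolyDen n} (h : IsConf n ε Xf f) (l i j : Fin n) :
    C (ε i) * liftX n (pderiv i (pderiv l (Xf j))) + C (ε j) * liftX n (pderiv j (pderiv l (Xf i))) =
    if i = j then 2 * C (ε i) * liftX n (pderiv l f) else 0 := by
  have := congrArg (pderiv (Sum.inl l)) (h.lift i j)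
  rw [map_add, der_C_mul, der_C_mul, dx_liftX, dx_liftX, pderiv_comm' l, pderiv_comm' l] at this
  rw [this]
  split_ifs
  · rw [show (2 * C (ε i) * liftX n f : PolySym n) = C (2 * ε i) * liftX n f by
      rw [C_mul]; rfl, der_C_mul, dx_liftX, C_mul]
    rfl
  · simp

/-- symmetrisation of a double sum -/
lemma sum_symm_eq {n : ℕ} {ε : Fin n → ℝ} {σ : Type*} (a b : Fin n → Fin n → MvPolynomial σ ℝ)
    (hb : ∀ i j, b i j = b j i) (F : MvPolynomial σ ℝ) 
    (ha : ∀ i j, a i j + a j i = if i = j then 2 * C (ε i) * F else 0) :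
    ∑ i, ∑ j, a i j * b i j = F * ∑ i, C (ε i) * b i i := by
  apply two_cancel
  have h1 : ∑ i, ∑ j, a i j * b i j = ∑ i, ∑ j, a j i * b i j := by
    rw [Finset.sum_comm]
    refine Finset.sum_congr rfl fun i _ => Finset.sum_congr rfl fun j _ => ?_
    rw [hb]
  calc 2 * ∑ i, ∑ j, a i j * b i j = ∑ i, ∑ j, a i j * b i j + ∑ i, ∑ j, a j i * b i j := by
        rw [← h1]; ring
    _ = ∑ i, ∑ j, (a i j + a j i) * b i j := by
        simp only [← Finset.sum_add_distrib, add_mul]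
    _ = _ := by
        simp only [ha, ite_mul, zero_mul, Finset.sum_ite_eq, Finset.mem_univ, if_true,
          Finset.mul_sum]
        refine Finset.sum_congr rfl fun i _ => by ring

lemma liftD_rQuad {n : ℕ} {ε : Fin n → ℝ} {Xf : PolyVF n}
    {f : PolyDen n} (h : IsConf n ε Xf f) :
    liftD n Xf (rQuad n ε) = - 2 * liftX n f * rQuad n ε := by
  have := sum_symm_eq (fun i j => C (ε i) * liftX n (pderiv i (Xf j)))
    (fun i j => pVar n i * pVar n j) (fun i j => mul_comm _ _) (liftX n f) h.lift
  rw [rQuad_eq, mul_assoc, ← this, map_sum, Finset.mul_sum]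
  refine Finset.sum_congr rfl fun i _ => ?_
  rw [der_C_mul, Derivation.leibniz, liftD_pVar, smul_eq_mul]
  simp only [Finset.mul_sum, ← Finset.sum_neg_distrib, ← Finset.sum_add_distrib]
  refine Finset.sum_congr rfl fun j _ => ?_
  ring

lemma grad_lift_comm {n : ℕ} {ε : Fin n → ℝ} {Xf : PolyVF n}
    {f : PolyDen n} (h : IsConf n ε Xf f) (P : PolySym n) :
    gradD n ε (liftD n Xf P) - liftD n Xf (gradD n ε P) =
      2 * liftX n f * gradD n ε P
        - rQuad n ε * ∑ l, liftX n (pderiv l f) * pderiv (Sum.inr l) P := by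
  classical
  have : ⁅gradD n ε, liftD n Xf⁆ = (2 * liftX n f) • gradD n ε
      - rQuad n ε • ∑ l, liftX n (pderiv l f) • pderiv (Sum.inr l) := by
    apply derivation_ext
    rintro (a | a)
    · have h0 : ∀ i : Fin n, pderiv (Sum.inr i) (X (Sum.inl a) : PolySym n) = 0 :=
        fun i => pderiv_X_of_ne (by simp)
      have h1 : gradD n ε (X (Sum.inl a)) = C (ε a) * pVar n a := by
        simp [gradD_apply, pderiv_X, Pi.single_apply]
      rw [Derivation.commutator_apply, liftD_X, h1, gradD_liftX, der_C_mul, liftD_pVar]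
      simp only [Derivation.sub_apply, Derivation.smul_apply, h1, der_sum_apply, h0, smul_eq_mul,
        mul_zero, Finset.sum_const_zero, sub_zero, MvPolynomial.smul_eq_C_mul, mul_neg, sub_neg_eq_add,
        Finset.mul_sum, ← Finset.sum_add_distrib]
      calc _ = ∑ i, pVar n i * (C (ε i) * liftX n (pderiv i (Xf a)) + C (ε a) * liftX n (pderiv a (Xf i))) :=
            Finset.sum_congr rfl fun i _ => by ring
        _ = _ := by
            simp only [h.lift, mul_ite, mul_zero, Finset.sum_ite_eq', Finset.mem_univ, if_true]
            ring
    · have := sum_symm_eq (fun i j => C (ε i) * liftX n (pderiv i (pderiv a (Xf j))))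
        (fun i j => pVar n i * pVar n j) (fun i j => mul_comm _ _) (liftX n (pderiv a f)) (h.lift2 a)
      have h2 : (X (Sum.inr a) : PolySym n) = pVar n a := rfl
      rw [Derivation.commutator_apply, h2, liftD_pVar, gradD_pVar, map_zero, sub_zero]
      simp only [Derivation.sub_apply, Derivation.smul_apply, der_sum_apply, smul_eq_mul,
        gradD_pVar, dp_pVar, mul_ite, mul_one, mul_zero, zero_sub, Finset.sum_ite_eq, Finset.mem_univ, if_true]
      rw [map_neg, mul_comm, rQuad_eq, ← this, Finset.sum_comm, map_sum]
      congr 1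
      refine Finset.sum_congr rfl fun j _ => ?_
      rw [Derivation.leibniz, gradD_pVar, gradD_liftX, smul_zero, add_zero, smul_eq_mul, Finset.mul_sum]
      refine Finset.sum_congr rfl fun i _ => by ring
  have h2 := DFunLike.congr_fun this P
  rw [Derivation.commutator_apply] at h2
  rw [h2]
  simp [der_sum_apply]

lemma dp_lift_comm {n : ℕ} (Xf : PolyVF n) (k : Fin n) (P : PolySym n) :
    pderiv (Sum.inr k) (liftD n Xf P) = liftD n Xf (pderiv (Sum.inr k) P)
      - ∑ i, liftX n (pderiv i (Xf k)) * pderiv (Sum.inr i) P := by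
  classical
  have : ⁅(pderiv (Sum.inr k) : Derivation ℝ (PolySym n) (PolySym n)), liftD n Xf⁆ =
      - ∑ i, liftX n (pderiv i (Xf k)) • pderiv (Sum.inr i) := by
    apply derivation_ext
    rintro (a | a)
    · have h0 : ∀ i : Fin n, pderiv (Sum.inr i) (X (Sum.inl a) : PolySym n) = 0 :=
        fun i => pderiv_X_of_ne (by simp)
      rw [Derivation.commutator_apply, liftD_X, dp_liftX, h0]
      simp [der_sum_apply, h0]
    · have h2 : (X (Sum.inr a) : PolySym n) = pVar n a := rfl
      rw [Derivation.commutator_apply, h2, liftD_pVar, dp_pVar]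
      have : liftD n Xf (if a = k then 1 else 0) = 0 := by split_ifs <;> simp
      rw [this]
      simp [der_sum_apply, dp_pVar, dp_liftX, Derivation.leibniz]
  have h2 := DFunLike.congr_fun this P
  rw [Derivation.commutator_apply] at h2
  rw [sub_eq_iff_eq_add] at h2
  rw [h2]
  simp [der_sum_apply]
  ring

lemma trace_lift {n : ℕ} {ε : Fin n → ℝ} (hε : ∀ i, ε i = 1 ∨ ε i = -1) {Xf : PolyVF n}
    {f : PolyDen n} (h : IsConf n ε Xf f) (P : PolySym n) :
    traceOp n ε (liftD n Xf P) = liftD n Xf (traceOp n ε P) - 2 * liftX n f * traceOp n ε P := by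
  have h' : ∀ i j, C (ε i) * liftX n (pderiv j (Xf i)) + C (ε j) * liftX n (pderiv i (Xf j)) =
      if i = j then 2 * C (ε i) * liftX n f else 0 := by
    intro i j
    have := h.lift i j
    by_cases hij : i = j
    · subst hij; exact this
    · rw [if_neg hij] at this ⊢
      rcases hε i with h1 | h1 <;> rcases hε j with h2 | h2 <;> rw [h1, h2] at this ⊢ <;>
        simp only [C_neg, C_1] at this ⊢
      · linear_combination this
      · linear_combination -this
      · linear_combination -this
      · linear_combination this
  have key := sum_symm_eq (fun i j => C (ε i) * liftX n (pderiv j (Xf i)))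
    (fun i j => pderiv (Sum.inr j) (pderiv (Sum.inr i) P)) (fun i j => pderiv_comm' _ _ _) (liftX n f) h'
  rw [traceOp_apply, traceOp_apply, mul_assoc, ← key, map_sum, Finset.mul_sum,
    ← Finset.sum_sub_distrib]
  refine Finset.sum_congr rfl fun i _ => ?_
  rw [dp_lift_comm, map_sub, dp_lift_comm, der_C_mul, map_sum]
  have : ∀ l, pderiv (Sum.inr i) (liftX n (pderiv l (Xf i)) * pderiv (Sum.inr l) P) =
      liftX n (pderiv l (Xf i)) * pderiv (Sum.inr l) (pderiv (Sum.inr i) P) := by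
    intro l
    rw [Derivation.leibniz, dp_liftX, pderiv_comm' (Sum.inr i)]
    simp
  simp only [this]
  have e : ∑ j, C (ε i) * liftX n (pderiv j (Xf i)) * (pderiv (Sum.inr j)) ((pderiv (Sum.inr i)) P)
    = C (ε i) * ∑ j, liftX n (pderiv j (Xf i)) * (pderiv (Sum.inr j)) ((pderiv (Sum.inr i)) P) := by
    rw [Finset.mul_sum]
    exact Finset.sum_congr rfl fun j _ => by ring
  rw [e]
  ring

lemma trace_liftX_mul {n : ℕ} (ε : Fin n → ℝ) (f : PolyDen n) (P : PolySym n) :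
    traceOp n ε (liftX n f * P) = liftX n f * traceOp n ε P := by
  rw [traceOp_apply, traceOp_apply, Finset.mul_sum]
  refine Finset.sum_congr rfl fun i _ => ?_
  have : ∀ S, pderiv (Sum.inr i) (liftX n f * S) = liftX n f * pderiv (Sum.inr i) S := by
    intro S
    rw [Derivation.leibniz, dp_liftX, smul_zero, add_zero, smul_eq_mul]
  rw [this, this]
  ring

lemma trace_Lop {n : ℕ} {ε : Fin n → ℝ} (hε : ∀ i, ε i = 1 ∨ ε i = -1) {Xf : PolyVF n}
    {f : PolyDen n} (h : IsConf n ε Xf f) (δ : ℝ) (P : PolySym n) (hP : traceOp n ε P = 0) :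
    traceOp n ε (Lop n δ Xf P) = 0 := by
  rw [Lop_eq, map_add, trace_lift hε h, hP, ← liftX_C, ← liftX_mul, trace_liftX_mul, hP]
  simp

/-! ### The commutation formula modulo the metric -/

lemma grad_dvd {n : ℕ} {ε : Fin n → ℝ} {A : PolySym n} (h : rQuad n ε ∣ A) :
    rQuad n ε ∣ gradD n ε A := by
  obtain ⟨Q, rfl⟩ := h
  rw [Derivation.leibniz, gradD_rQuad, smul_zero, add_zero, smul_eq_mul]
  exact dvd_mul_right _ _

lemma Lop_dvd {n : ℕ} {ε : Fin n → ℝ} {Xf : PolyVF n}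
    {f : PolyDen n} (h : IsConf n ε Xf f) (δ : ℝ) {A : PolySym n} (hA : rQuad n ε ∣ A) :
    rQuad n ε ∣ Lop n δ Xf A := by
  obtain ⟨Q, rfl⟩ := hA
  rw [Lop_eq, Derivation.leibniz, liftD_rQuad h, smul_eq_mul, smul_eq_mul]
  refine ⟨liftD n Xf Q - 2 * liftX n f * Q + C δ * liftX n (divVF n Xf) * Q, ?_⟩
  ring

lemma grad_step {n : ℕ} (hn : n ≠ 0) {ε : Fin n → ℝ} (hε : ∀ i, ε i = 1 ∨ ε i = -1)
    {Xf : PolyVF n} {f : PolyDen n} (h : IsConf n ε Xf f) (δ : ℝ) (P : PolySym n) :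
    rQuad n ε ∣ gradD n ε (Lop n δ Xf P) - Lop n (δ + 2 / n) Xf (gradD n ε P)
      - C (n * δ) * gradD n ε (liftX n f) * P := by
  refine ⟨- ∑ l, liftX n (pderiv l f) * pderiv (Sum.inr l) P, ?_⟩
  have h1 := grad_lift_comm h P
  have hn' : (n : ℝ) ≠ 0 := by exact_mod_cast hn
  have e1 : C δ * liftX n (divVF n Xf) = C (n * δ) * liftX n f := by
    rw [h.div hε, liftX_mul, liftX_C, C_mul]; ring
  have e2 : C (δ + 2 / n) * liftX n (divVF n Xf) = C (n * δ) * liftX n f + 2 * liftX n f := by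
    rw [h.div hε, liftX_mul, liftX_C, ← mul_assoc, ← C_mul,
      show (δ + 2 / n) * (n : ℝ) = n * δ + 2 by field_simp, C_add, add_mul]
    rfl
  rw [Lop_eq, Lop_eq, e1, e2, map_add, mul_assoc, der_C_mul, Derivation.leibniz, smul_eq_mul,
    smul_eq_mul]
  linear_combination h1

lemma grad_pow {n : ℕ} (hn : n ≠ 0) {ε : Fin n → ℝ} (hε : ∀ i, ε i = 1 ∨ ε i = -1)
    {Xf : PolyVF n} {f : PolyDen n} (h : IsConf n ε Xf f)
    (hq : gradD n ε (gradD n ε (liftX n f)) = 0) (δ : ℝ) (P : PolySym n) (g : ℕ) :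
    rQuad n ε ∣ (gradOp n ε ^ g) (Lop n δ Xf P)
      - Lop n (δ + 2 * g / n) Xf ((gradOp n ε ^ g) P)
      - C (g * (n * δ + g - 1)) * gradD n ε (liftX n f) * (gradOp n ε ^ (g - 1)) P := by
  have hn' : (n : ℝ) ≠ 0 := by exact_mod_cast hn
  induction g with
  | zero => simp
  | succ g ih =>
    have h1 := grad_dvd ih
    have h2 := grad_step hn hε h (δ + 2 * g / n) ((gradOp n ε ^ g) P)
    have h3 : C (g * (n * δ + g - 1) : ℝ) * gradD n ε ((gradOp n ε ^ (g - 1)) P)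
        = C (g * (n * δ + g - 1) : ℝ) * (gradOp n ε ^ g) P := by
      cases g with
      | zero => simp
      | succ m => rw [pow_succ', Module.End.mul_apply, gradOp_eq]; rfl
    rw [map_sub, map_sub, mul_assoc, der_C_mul, Derivation.leibniz, hq, smul_zero, add_zero,
      smul_eq_mul, mul_left_comm, h3] at h1
    have h4 := dvd_add h1 h2
    have e1 : δ + 2 * (g : ℝ) / n + 2 / n = δ + 2 * ((g + 1 : ℕ) : ℝ) / n := by
      push_cast; ring
    have e2 : (C (((g + 1 : ℕ) : ℝ) * (n * δ + ((g + 1 : ℕ) : ℝ) - 1)) : PolySym n) =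
        C (g * (n * δ + g - 1) : ℝ) + C (n * (δ + 2 * g / n)) := by
      rw [← C_add]; congr 1; push_cast; field_simp; ring
    rw [e1] at h4
    rw [e2, pow_succ', Module.End.mul_apply, Module.End.mul_apply, gradOp_eq, gradOp_eq,
      Nat.add_sub_cancel]
    convert h4 using 1
    ring

lemma proj_pow {n : ℕ} {ε : Fin n → ℝ} {π0 : Module.End ℝ (PolySym n)}
    (hπ2 : ∀ P : PolySym n, ∃ Q : PolySym n, P - π0 P = rQuad n ε * Q) (P : PolySym n) (g : ℕ) :
    rQuad n ε ∣ (gradOp n ε ^ g) P - ((π0 ∘ₗ gradOp n ε) ^ g) P := by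
  induction g with
  | zero => simp
  | succ g ih =>
    rw [pow_succ', pow_succ', Module.End.mul_apply, Module.End.mul_apply, LinearMap.comp_apply,
      gradOp_eq, gradOp_eq]
    have h1 := grad_dvd ih
    rw [map_sub] at h1
    have h2 : rQuad n ε ∣ _ := hπ2 (gradD n ε (((π0 ∘ₗ gradOp n ε) ^ g) P))
    simpa using dvd_add h1 h2

lemma full_formula {n : ℕ} (hn : n ≠ 0) {ε : Fin n → ℝ} (hε : ∀ i, ε i = 1 ∨ ε i = -1)
    {π0 : Module.End ℝ (PolySym n)}
    (hπ2 : ∀ P : PolySym n, ∃ Q : PolySym n, P - π0 P = rQuad n ε * Q)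
    {Xf : PolyVF n} {f : PolyDen n} (h : IsConf n ε Xf f)
    (hq : gradD n ε (gradD n ε (liftX n f)) = 0) (δ : ℝ) (P : PolySym n) (g : ℕ) :
    rQuad n ε ∣ ((π0 ∘ₗ gradOp n ε) ^ g) (Lop n δ Xf P)
      - Lop n (δ + 2 * g / n) Xf (((π0 ∘ₗ gradOp n ε) ^ g) P)
      - C (g * (n * δ + g - 1)) * gradD n ε (liftX n f) * (gradOp n ε ^ (g - 1)) P := by
  have h1 := grad_pow hn hε h hq δ P g
  have h2 := proj_pow hπ2 (Lop n δ Xf P) g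
  have h3 := Lop_dvd h (δ + 2 * g / n) (proj_pow hπ2 P g)
  rw [map_sub] at h3
  convert dvd_add (dvd_sub h1 h2) h3 using 1
  ring

/-! ### Generators are conformal -/

lemma eps_sq {n : ℕ} {ε : Fin n → ℝ} (hε : ∀ i, ε i = 1 ∨ ε i = -1) (i : Fin n) :
    (C (ε i) * C (ε i) : PolyDen n) = 1 := by
  rcases hε i with h | h <;> simp [h]

lemma isConf_trans {n : ℕ} (ε : Fin n → ℝ) (i : Fin n) : IsConf n ε (transVF n i) 0 := by
  intro a b
  simp [transVF, apply_ite]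

lemma isConf_dil {n : ℕ} (ε : Fin n → ℝ) : IsConf n ε (dilVF n) 1 := by
  intro a b
  by_cases h : a = b
  · subst h; simp [dilVF]; ring
  · simp [dilVF, h, pderiv_X_of_ne, Ne.symm h]

lemma pderiv_X_ite {n : ℕ} (i j : Fin n) :
    pderiv i (X j : PolyDen n) = if i = j then 1 else 0 := by
  rw [pderiv_X]
  by_cases h : i = j
  · subst h; simp
  · simp [h, Ne.symm h]

lemma isConf_rot {n : ℕ} {ε : Fin n → ℝ} (hε : ∀ i, ε i = 1 ∨ ε i = -1) (i j : Fin n) :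
    IsConf n ε (rotVF n ε i j) 0 := by
  intro a b
  have key : ∀ a b, pderiv a (rotVF n ε i j b) =
      (if b = i then if a = j then C (ε j) else 0 else 0)
        - (if b = j then if a = i then C (ε i) else 0 else 0) := by
    intro a b
    simp only [rotVF, map_sub, apply_ite (pderiv a), map_zero, smul_eq_C_mul, der_C_mul,
      pderiv_X_ite, mul_ite, mul_one, mul_zero]
  rw [key, key, mul_zero, ite_self]
  have ha := eps_sq hε a
  have hb := eps_sq hε b
  split_ifs <;> subst_vars <;> first
    | (exfalso; simp_all; done)
    | linear_combination 0
    | linear_combination ha - hb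
    | linear_combination hb - ha

lemma isConf_inv {n : ℕ} {ε : Fin n → ℝ} (hε : ∀ i, ε i = 1 ∨ ε i = -1) (i : Fin n) :
    IsConf n ε (invVF n ε i) (C (-2 * ε i) * X i) := by
  intro a b
  have key : ∀ a b, pderiv a (invVF n ε i b) =
      (if b = i then 2 * (C (ε a) * X a) else 0)
        - 2 * C (ε i) * ((if a = b then X i else 0) + (if a = i then X b else 0)) := by
    intro a b
    have h1 : pderiv a (∑ m, ε m • (X m * X m) : PolyDen n) = 2 * (C (ε a) * X a) := by
      simp only [map_sum, smul_eq_C_mul, der_C_mul]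
      rw [Finset.sum_eq_single a]
      · rw [Derivation.leibniz, pderiv_X_self, smul_eq_mul]; ring
      · intro m _ hm
        rw [Derivation.leibniz, pderiv_X_of_ne hm]; simp
      · simp
    rw [invVF, map_sub, apply_ite (pderiv a), map_zero, h1, smul_eq_C_mul, der_C_mul,
      Derivation.leibniz, pderiv_X_ite, pderiv_X_ite, C_mul]
    simp only [smul_eq_mul, mul_ite, mul_one, mul_zero]
    rfl
  rw [key, key]
  have hc : (C (-2 * ε i) : PolyDen n) = - 2 * C (ε i) := by
    rw [C_mul, C_neg]; rfl
  have ha := eps_sq hε a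
  have hb := eps_sq hε b
  have hi := eps_sq hε i
  rw [hc]
  by_cases h3 : a = b
  · subst h3
    by_cases h1 : a = i
    · subst h1
      simp only [if_true]
      ring
    · simp only [h1, if_true, if_false]
      ring
  · have h3' : ¬ b = a := fun h => h3 h.symm
    by_cases h1 : a = i
    · subst h1
      simp only [h3, h3', if_true, if_false]
      linear_combination (2 * X b) * hb - 2 * X b * ha
    · by_cases h2 : b = i
      · subst h2
        simp only [h3, h3', if_true, if_false]
        linear_combination (2 * X a) * ha - 2 * X a * hb
      · simp only [h1, h2, h3, h3', if_false]
        ring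

lemma grad_inv {n : ℕ} {ε : Fin n → ℝ} (hε : ∀ i, ε i = 1 ∨ ε i = -1) (i : Fin n) :
    gradD n ε (liftX n (C (-2 * ε i) * X i)) = C (-2) * pVar n i := by
  have : ε i * ε i = 1 := by rcases hε i with h | h <;> simp [h]
  rw [liftX_mul, liftX_C, der_C_mul, gradD_liftX]
  simp only [pderiv_X_ite]
  rw [Finset.sum_eq_single i]
  · rw [if_pos rfl, show liftX n 1 = 1 from map_one _, mul_one, ← mul_assoc, ← C_mul, mul_assoc, this,
      mul_one]
  · intro j _ hj
    rw [if_neg hj, show liftX n 0 = 0 from map_zero _, mul_zero]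
  · simp

lemma conf_gen {n : ℕ} {ε : Fin n → ℝ} (hε : ∀ i, ε i = 1 ∨ ε i = -1) {Xf : PolyVF n}
    (h : Xf ∈ confGenSet n ε) :
    ∃ f, IsConf n ε Xf f ∧ gradD n ε (gradD n ε (liftX n f)) = 0 := by
  rcases h with ((⟨i, rfl⟩ | ⟨i, j, rfl⟩) | h) | ⟨i, rfl⟩
  · exact ⟨0, isConf_trans ε i, by simp [liftX]⟩
  · exact ⟨0, isConf_rot hε i j, by simp [liftX]⟩
  · rw [Set.mem_singleton_iff] at h
    subst h
    exact ⟨1, isConf_dil ε, by simp [liftX]⟩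
  · exact ⟨_, isConf_inv hε i, by rw [grad_inv hε, der_C_mul, gradD_pVar, mul_zero]⟩

/-! ### A test symbol -/

/-- Powers of the (split-)complex number `p_a + j p_b`, `j² = s`. -/
def zPow (n : ℕ) (s : ℝ) (a b : Fin n) : ℕ → PolySym n × PolySym n
  | 0 => (1, 0)
  | k + 1 => (pVar n a * (zPow n s a b k).1 + C s * pVar n b * (zPow n s a b k).2,
      pVar n a * (zPow n s a b k).2 + pVar n b * (zPow n s a b k).1)

lemma zPow_homog (n : ℕ) (s : ℝ) (a b : Fin n) (k : ℕ) :
    IsPHomog n (zPow n s a b k).1 k ∧ IsPHomog n (zPow n s a b k).2 k := by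
  have hp : ∀ i, IsWeightedHomogeneous (pwt n) (pVar n i) 1 := fun i =>
    isWeightedHomogeneous_X ℝ (pwt n) (Sum.inr i)
  unfold IsPHomog
  induction k with
  | zero => exact ⟨isWeightedHomogeneous_one _ _, isWeightedHomogeneous_zero _ _ _⟩
  | succ k ih =>
    rw [add_comm k 1]
    refine ⟨?_, ?_⟩
    · have := ((hp a).mul ih.1).add (((hp b).C_mul s).mul ih.2)
      rwa [add_comm 1 k] at this ⊢
    · have := ((hp a).mul ih.2).add ((hp b).mul ih.1)
      rwa [add_comm 1 k] at this ⊢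

lemma zPow_grad (n : ℕ) (ε : Fin n → ℝ) (s : ℝ) (a b : Fin n) (k : ℕ) :
    gradD n ε (zPow n s a b k).1 = 0 ∧ gradD n ε (zPow n s a b k).2 = 0 := by
  induction k with
  | zero => simp [zPow]
  | succ k ih => simp [zPow, Derivation.leibniz, gradD_pVar, gradD_C, ih.1, ih.2]

lemma zPow_da (n : ℕ) (s : ℝ) {a b : Fin n} (hab : a ≠ b) (k : ℕ) :
    pderiv (Sum.inr a) (zPow n s a b (k+1)).1 = C ((k : ℝ) + 1) * (zPow n s a b k).1 ∧
    pderiv (Sum.inr a) (zPow n s a b (k+1)).2 = C ((k : ℝ) + 1) * (zPow n s a b k).2 := by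
  induction k with
  | zero => simp [zPow, dp_pVar, Derivation.leibniz, hab.symm]
  | succ k ih =>
    rw [zPow]
    simp only [map_add, Derivation.leibniz, ih.1, ih.2, dp_pVar, hab.symm, if_true, if_false,
      smul_eq_mul, pderiv_C, mul_zero, mul_one, add_zero]
    constructor
    · conv_rhs => rw [zPow]
      conv_lhs => rw [zPow]
      simp only [Nat.cast_add, Nat.cast_one, C_add, C_1]
      ring
    · conv_rhs => rw [zPow]
      conv_lhs => rw [zPow]
      simp only [Nat.cast_add, Nat.cast_one, C_add, C_1]
      ring

lemma zPow_db (n : ℕ) (s : ℝ) {a b : Fin n} (hab : a ≠ b) (k : ℕ) :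
    pderiv (Sum.inr b) (zPow n s a b (k+1)).1 = C ((k : ℝ) + 1) * (C s * (zPow n s a b k).2) ∧
    pderiv (Sum.inr b) (zPow n s a b (k+1)).2 = C ((k : ℝ) + 1) * (zPow n s a b k).1 := by
  induction k with
  | zero => simp [zPow, dp_pVar, Derivation.leibniz, hab]
  | succ k ih =>
    rw [zPow]
    simp only [map_add, Derivation.leibniz, ih.1, ih.2, dp_pVar, hab, if_true, if_false,
      smul_eq_mul, pderiv_C, mul_zero, mul_one, add_zero]
    constructor
    · conv_rhs => rw [zPow]
      conv_lhs => rw [zPow]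
      simp only [Nat.cast_add, Nat.cast_one, C_add, C_1]
      ring
    · conv_rhs => rw [zPow]
      conv_lhs => rw [zPow]
      simp only [Nat.cast_add, Nat.cast_one, C_add, C_1]
      ring

lemma zPow_dc (n : ℕ) (s : ℝ) {a b c : Fin n} (ha : a ≠ c) (hb : b ≠ c) (k : ℕ) :
    pderiv (Sum.inr c) (zPow n s a b k).1 = 0 ∧ pderiv (Sum.inr c) (zPow n s a b k).2 = 0 := by
  induction k with
  | zero => simp [zPow]
  | succ k ih => simp [zPow, Derivation.leibniz, dp_pVar, ha, hb, ih.1, ih.2]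

lemma zPow_trace (n : ℕ) (ε : Fin n → ℝ) (hε : ∀ i, ε i = 1 ∨ ε i = -1) {a b : Fin n}
    (hab : a ≠ b) (k : ℕ) : traceOp n ε (zPow n (-(ε a * ε b)) a b k).1 = 0 := by
  rw [traceOp_apply]
  match k with
  | 0 => simp [zPow]
  | 1 => 
    refine Finset.sum_eq_zero fun c _ => ?_
    by_cases ha : c = a
    · subst ha; rw [(zPow_da n _ hab 0).1]; simp [zPow]
    by_cases hb : c = b
    · subst hb; rw [(zPow_db n _ hab 0).1]; simp [zPow]
    rw [(zPow_dc n _ (Ne.symm ha) (Ne.symm hb) _).1]; simp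
  | k + 2 =>
    rw [Fintype.sum_eq_add a b hab]
    · rw [(zPow_da n _ hab (k+1)).1, (zPow_db n _ hab (k+1)).1, der_C_mul, der_C_mul, der_C_mul,
        (zPow_da n _ hab k).1, (zPow_db n _ hab k).2]
      have : ε b * -(ε a * ε b) = - ε a := by rcases hε b with h | h <;> simp [h]
      have h2 : (C (ε b) * C (-(ε a * ε b)) : PolySym n) = - C (ε a) := by rw [← C_mul, this, C_neg]
      linear_combination (C (((k + 1 : ℕ) : ℝ) + 1) * C ((k : ℝ) + 1) *
        (zPow n (-(ε a * ε b)) a b k).1) * h2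
    · rintro c ⟨ha, hb⟩
      rw [(zPow_dc n _ (Ne.symm ha) (Ne.symm hb) _).1]; simp

lemma grad_pow_test {n : ℕ} (ε : Fin n → ℝ) (a : Fin n) (m : ℕ) :
    ∀ u : PolySym n, gradD n ε u = 0 →
      (gradOp n ε ^ m) (liftX n (X a ^ m) * u) = C (m.factorial : ℝ) * (C (ε a) * pVar n a) ^ m * u := by
  have hx : gradD n ε (liftX n (X a)) = C (ε a) * pVar n a := by
    rw [gradD_liftX, Finset.sum_eq_single a]
    · rw [pderiv_X_self, show liftX n 1 = 1 from map_one _, mul_one]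
    · intro j _ hj
      rw [pderiv_X_of_ne hj.symm, show liftX n 0 = 0 from map_zero _, mul_zero]
    · simp
  have hl : ∀ m, liftX n (X a ^ m) = (liftX n (X a)) ^ m := fun m => map_pow _ _ _
  induction m with
  | zero => intro u _; simp [liftX]
  | succ m ih =>
    intro u hu
    rw [pow_succ, Module.End.mul_apply, gradOp_eq, Derivation.leibniz, hu, smul_zero, zero_add, hl,
      Derivation.leibniz_pow, hx, Nat.add_sub_cancel, ← hl]
    have e : u • (m + 1) • liftX n (X a ^ m) • (C (ε a) * pVar n a)
        = liftX n (X a ^ m) * (C ((m + 1 : ℕ) : ℝ) * (C (ε a) * pVar n a) * u) := by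
      simp only [smul_eq_mul, nsmul_eq_mul, ← map_natCast (C : ℝ →+* PolySym n)]
      ring
    rw [e, ih]
    · rw [Nat.factorial_succ, Nat.cast_mul, C_mul]; ring
    · rw [mul_assoc, mul_assoc, der_C_mul, der_C_mul, Derivation.leibniz, hu, gradD_pVar]
      simp

/-- A complex isotropic point. -/
def isoPt (n : ℕ) (a b : Fin n) (w : ℂ) : PolySym n →ₐ[ℝ] ℂ :=
  aeval (Sum.elim (fun _ => 0) (fun c => if c = a then 1 else if c = b then w else 0))

lemma isoPt_p (n : ℕ) (a b : Fin n) (w : ℂ) (c : Fin n) :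
    isoPt n a b w (pVar n c) = if c = a then 1 else if c = b then w else 0 := by
  simp [isoPt, pVar]

lemma isoPt_C (n : ℕ) (a b : Fin n) (w : ℂ) (r : ℝ) :
    isoPt n a b w (C r) = (r : ℂ) := by
  simp [isoPt]

lemma isoPt_zPow (n : ℕ) {a b : Fin n} (hab : a ≠ b) (s : ℝ) (w : ℂ) (hw : w * w = s) (k : ℕ) :
    isoPt n a b w (zPow n s a b k).1 + w * isoPt n a b w (zPow n s a b k).2 = (1 + (s : ℂ)) ^ k ∧
    isoPt n a b w (zPow n s a b k).1 - w * isoPt n a b w (zPow n s a b k).2 = (1 - (s : ℂ)) ^ k := by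
  induction k with
  | zero => simp [zPow]
  | succ k ih =>
    rw [pow_succ, pow_succ, ← ih.1, ← ih.2]
    simp only [zPow, map_add, map_mul, isoPt_p, isoPt_C, if_true, hab.symm, if_false]
    constructor
    · linear_combination (isoPt n a b w (zPow n s a b k).1) * hw
    · linear_combination (-isoPt n a b w (zPow n s a b k).1) * hw

lemma test_coeff_zero {n : ℕ} {ε : Fin n → ℝ} (hε : ∀ i, ε i = 1 ∨ ε i = -1) {a b : Fin n}
    (hab : a ≠ b) (k m : ℕ) (c : ℝ)
    (h : rQuad n ε ∣ C c * (C (-2) * pVar n a) * (C (m.factorial : ℝ) * (C (ε a) * pVar n a) ^ m *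
      (zPow n (-(ε a * ε b)) a b k).1)) : c = 0 := by
  obtain ⟨w, hw⟩ : ∃ w : ℂ, w * w = ((-(ε a * ε b) : ℝ) : ℂ) := by
    obtain ⟨w, hw⟩ := IsAlgClosed.exists_pow_nat_eq ((-(ε a * ε b) : ℝ) : ℂ) (n := 2) (by norm_num)
    exact ⟨w, by rw [← sq, hw]⟩
  have hR : isoPt n a b w (rQuad n ε) = 0 := by
    rw [rQuad_eq, map_sum, Fintype.sum_eq_add a b hab]
    · simp only [map_mul, isoPt_p, isoPt_C, if_true, hab.symm, if_false]
      rw [hw, ← Complex.ofReal_mul]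
      have : ε b * -(ε a * ε b) = - ε a := by rcases hε b with h | h <;> simp [h]
      rw [this]; simp
    · rintro x ⟨h1, h2⟩
      simp [isoPt_p, h1, h2]
  have hu : isoPt n a b w (zPow n (-(ε a * ε b)) a b k).1 ≠ 0 := by
    intro h0
    have h1 := isoPt_zPow n hab _ w hw k
    have h2 : (1 + ((-(ε a * ε b) : ℝ) : ℂ)) ^ k + (1 - ((-(ε a * ε b) : ℝ) : ℂ)) ^ k = 0 := by
      rw [← h1.1, ← h1.2, h0]; ring
    have hs : ε a * ε b = 1 ∨ ε a * ε b = -1 := by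
      rcases hε a with h | h <;> rcases hε b with h' | h' <;> simp [h, h']
    rcases k.eq_zero_or_pos with rfl | hk
    · norm_num at h2
    · rcases hs with hs | hs <;> rw [hs] at h2 <;> norm_num [hk.ne'] at h2
  have h1 := map_dvd (isoPt n a b w) h
  rw [hR, zero_dvd_iff] at h1
  have ha : ((ε a : ℝ) : ℂ) ≠ 0 := by rcases hε a with h | h <;> simp [h]
  have hf : ((m.factorial : ℕ) : ℂ) ≠ 0 := by exact_mod_cast m.factorial_ne_zero
  simp only [map_mul, map_pow, isoPt_p, isoPt_C, if_true, mul_eq_zero, hu, or_false, mul_one,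
    pow_eq_zero_iff', ha, false_and, Complex.ofReal_natCast, hf, Complex.ofReal_eq_zero] at h1
  simpa using h1

/-- The operator `G_0^g : S^δ_{k,0} → S^{δ+2g/n}_{k+g,0}` (the
`g`-generalized conformal Killing operator) is conformally invariant if and only if
`δ = (1-g)/n`. -/
theorem gradOp_pow_conformally_invariant_iff (n k g : ℕ) (h3 : 3 ≤ n) (hg : 1 ≤ g) (δ : ℝ)
    (ε : Fin n → ℝ) (hε : ∀ i, ε i = 1 ∨ ε i = -1) (π0 : Module.End ℝ (PolySym n))
    (hπ1 : ∀ P : PolySym n, traceOp n ε (π0 P) = 0)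
    (hπ2 : ∀ P : PolySym n, ∃ Q : PolySym n, P - π0 P = rQuad n ε * Q) :
    (∀ Xf ∈ confGenSet n ε, ∀ P : PolySym n, IsPHomog n P k → traceOp n ε P = 0 →
        Lop n (δ + 2 * (g : ℝ) / (n : ℝ)) Xf (((π0 ∘ₗ gradOp n ε) ^ g) P)
          = ((π0 ∘ₗ gradOp n ε) ^ g) (Lop n δ Xf P))
      ↔ δ = (1 - (g : ℝ)) / (n : ℝ) := by
  have hn : n ≠ 0 := by omega
  have hn' : (n : ℝ) ≠ 0 := by exact_mod_cast hn
  have hg' : (g : ℝ) ≠ 0 := by exact_mod_cast (by omega : g ≠ 0)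
  have hδ : δ = (1 - (g : ℝ)) / (n : ℝ) ↔ (g : ℝ) * (n * δ + g - 1) = 0 := by
    rw [eq_div_iff hn', mul_eq_zero, or_iff_right hg']
    constructor <;> intro h <;> linarith
  rw [hδ]
  constructor
  · intro H
    let a : Fin n := ⟨0, by omega⟩
    let b : Fin n := ⟨1, by omega⟩
    have hab : a ≠ b := by simp [a, b, Fin.ext_iff]
    have hX : invVF n ε a ∈ confGenSet n ε := Or.inr ⟨a, rfl⟩
    have hq : gradD n ε (gradD n ε (liftX n (C (-2 * ε a) * X a))) = 0 := by
      rw [grad_inv hε, der_C_mul, gradD_pVar, mul_zero]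
    let u := (zPow n (-(ε a * ε b)) a b k).1
    have hP1 : IsPHomog n (liftX n (X a ^ (g - 1)) * u) k := by
      have h1 : IsWeightedHomogeneous (pwt n) (liftX n (X a ^ (g - 1))) 0 := by
        have h2 : liftX n (X a ^ (g - 1)) = (X (Sum.inl a) : PolySym n) ^ (g - 1) := by
          simp [liftX]
        rw [h2]
        have := (isWeightedHomogeneous_X ℝ (pwt n) (Sum.inl a)).pow (g - 1)
        simpa [pwt] using this
      have := h1.mul (zPow_homog n (-(ε a * ε b)) a b k).1
      rwa [zero_add] at this
    have hP2 : traceOp n ε (liftX n (X a ^ (g - 1)) * u) = 0 := by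
      rw [trace_liftX_mul, zPow_trace n ε hε hab, mul_zero]
    have h1 := H _ hX _ hP1 hP2
    have h2 := full_formula hn hε hπ2 (isConf_inv hε a) hq δ (liftX n (X a ^ (g - 1)) * u) g
    rw [h1, sub_self, zero_sub, dvd_neg, grad_inv hε,
      grad_pow_test ε a (g - 1) u (zPow_grad n ε _ a b k).1] at h2
    exact test_coeff_zero hε hab k (g - 1) _ h2
  · intro hc Xf hX P _ _
    obtain ⟨f, hf, hq⟩ := conf_gen hε hX
    have h2 := full_formula hn hε hπ2 hf hq δ P g
    rw [hc, C_0, zero_mul, zero_mul, sub_zero] at h2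
    have ht : ∀ S, traceOp n ε (((π0 ∘ₗ gradOp n ε) ^ g) S) = 0 := by
      intro S
      obtain ⟨m, rfl⟩ : ∃ m, g = m + 1 := ⟨g - 1, by omega⟩
      rw [pow_succ', Module.End.mul_apply, LinearMap.comp_apply]
      exact hπ1 _
    exact (eq_of_traceless (ht _) (trace_Lop hε hf _ _ (ht P)) h2).symm
end
end
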